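/- Let R be an extraspecial 2-group of plus type of order 2^{1+2d}, d ≥ 2, and let t be an automorphism of R of order at most 2 inducing an even (Dickson invariant 0) action on R/Z(R) such that [R,t] is not contained in Z(R). Then [R,t] is abelian, t inverts [R,t], and t centralizes Ω₁([R,t]); in particular t fixes a noncentral involution of R. -/

import Mathlib

section InvolutionCommutator

variable {R : Type*} [Group R]

/-- In a group with center of order two, all nontrivial central elements coincide. -/
theorem eq_of_mem_center_of_ne_one (hZ : Nat.card (Subgroup.center R) = 2) {a b : R}
    (ha : a ∈ Subgroup.center R) (hb : b ∈ Subgroup.center R) (ha1 : a ≠ 1) (hb1 : b ≠ 1) :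
    a = b := by
  obtain ⟨z, -, hz⟩ := (Nat.card_eq_two_iff' (1 : Subgroup.center R)).1 hZ
  have h₁ := hz ⟨a, ha⟩ (by simpa [Subtype.ext_iff] using ha1)
  have h₂ := hz ⟨b, hb⟩ (by simpa [Subtype.ext_iff] using hb1)
  exact congrArg Subtype.val (h₁.trans h₂.symm)

/-- An automorphism fixes a center of order two pointwise. -/
theorem map_eq_self_of_mem_center (hZ : Nat.card (Subgroup.center R) = 2) (t : R ≃* R) {c : R}
    (hc : c ∈ Subgroup.center R) : t c = c := by
  by_cases h : c = 1
  · simp [h]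
  · refine eq_of_mem_center_of_ne_one hZ ?_ hc (by simpa using h) h
    rw [Subgroup.mem_center_iff] at hc ⊢
    intro g
    obtain ⟨g, rfl⟩ := t.surjective g
    rw [← map_mul, ← map_mul, hc]

theorem mul_mul_inv_mul_inv_mem_center (hcomm : commutator R = Subgroup.center R) (x y : R) :
    x * y * x⁻¹ * y⁻¹ ∈ Subgroup.center R := by
  rw [← hcomm, commutator_def]
  exact Subgroup.commutator_mem_commutator (Subgroup.mem_top x) (Subgroup.mem_top y)

/-- If an automorphism inverts `a`, and commutators are central of order at most two,
then `a` commutes with every `y⁻¹ * t y`. -/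
theorem commute_inv_mul_map (hZ : Nat.card (Subgroup.center R) = 2)
    (hcomm : commutator R = Subgroup.center R) (t : R ≃* R) {a : R} (ha : t a = a⁻¹) (y : R) :
    Commute a (y⁻¹ * t y) := by
  obtain ⟨c, hc, hcy⟩ : ∃ c ∈ Subgroup.center R, a * y = c * y * a :=
    ⟨_, mul_mul_inv_mul_inv_mem_center hcomm a y, by group⟩
  have htc := map_eq_self_of_mem_center hZ t hc
  have hz := Subgroup.mem_center_iff.1 hc
  have ht : a⁻¹ * t y = c * t y * a⁻¹ := by
    simpa only [map_mul, ha, htc] using congrArg t hcy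
  have h₁ : a * (c * t y) = t y * a := by
    calc a * (c * t y) = a * (c * t y * a⁻¹) * a := by group
      _ = t y * a := by rw [← ht]; group
  have h₂ : a * y⁻¹ = y⁻¹ * a * c := by
    calc a * y⁻¹ = y⁻¹ * (y * a * c) * c⁻¹ * y⁻¹ := by group
      _ = y⁻¹ * (a * y) * c⁻¹ * y⁻¹ := by rw [hz, hcy, ← mul_assoc c]
      _ = y⁻¹ * a * (y * c⁻¹) * y⁻¹ := by group
      _ = y⁻¹ * a * c⁻¹ := by
        rw [Subgroup.mem_center_iff.1 (inv_mem hc) y]; group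
      _ = y⁻¹ * a * c := by
        by_cases h : c = 1
        · simp [h]
        · rw [eq_of_mem_center_of_ne_one hZ (inv_mem hc) hc (by simpa using h) h]
  calc a * (y⁻¹ * t y) = y⁻¹ * (a * (c * t y)) := by rw [← mul_assoc, h₂]; group
    _ = y⁻¹ * t y * a := by rw [h₁, mul_assoc]

/-- The endomorphism `x ↦ x⁻¹ * t x` of the central quotient of a group whose commutators are
central. -/
def centralQuotientInvMulMap (hZ : Nat.card (Subgroup.center R) = 2)
    (hcomm : commutator R = Subgroup.center R) (t : R ≃* R) :
    R ⧸ Subgroup.center R →* R ⧸ Subgroup.center R :=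
  QuotientGroup.lift (Subgroup.center R)
    { toFun := fun r => ((r⁻¹ * t r : R) : R ⧸ Subgroup.center R)
      map_one' := by simp
      map_mul' := fun x y => by
        have hab : ∀ u v : R, ((u * v : R) : R ⧸ Subgroup.center R) = (v * u : R) := fun u v => by
          rw [QuotientGroup.eq]
          simpa [mul_assoc] using mul_mul_inv_mul_inv_mem_center hcomm v⁻¹ u⁻¹
        calc (((x * y)⁻¹ * t (x * y) : R) : R ⧸ Subgroup.center R)
            = ((y⁻¹ * (x⁻¹ * t x) : R) : R ⧸ Subgroup.center R) * (t y : R) := by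
              rw [← QuotientGroup.mk_mul]; simp [mul_assoc]
          _ = _ := by rw [hab]; simp only [QuotientGroup.mk_mul, mul_assoc] }
    (fun z hz => by
      simp [map_eq_self_of_mem_center hZ t hz])

theorem centralQuotientInvMulMap_mk (hZ : Nat.card (Subgroup.center R) = 2)
    (hcomm : commutator R = Subgroup.center R) (t : R ≃* R) (r : R) :
    centralQuotientInvMulMap hZ hcomm t r = ((r⁻¹ * t r : R) : R ⧸ Subgroup.center R) :=
  rfl

theorem coe_ker_centralQuotientInvMulMap (hZ : Nat.card (Subgroup.center R) = 2)
    (hcomm : commutator R = Subgroup.center R) (t : R ≃* R) :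
    ((centralQuotientInvMulMap hZ hcomm t).ker : Set (R ⧸ Subgroup.center R)) =
      {x | ∃ r : R, (r : R ⧸ Subgroup.center R) = x ∧
        ((t r : R) : R ⧸ Subgroup.center R) = x} := by
  ext x
  obtain ⟨r, rfl⟩ := QuotientGroup.mk_surjective x
  rw [SetLike.mem_coe, MonoidHom.mem_ker, centralQuotientInvMulMap_mk, QuotientGroup.mk_mul,
    QuotientGroup.mk_inv, inv_mul_eq_one]
  refine ⟨fun h => ⟨r, rfl, h.symm⟩, ?_⟩
  rintro ⟨s, hs, hts⟩
  have hz := QuotientGroup.eq.1 hs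
  have := map_eq_self_of_mem_center hZ t hz
  rw [map_mul, map_inv] at this
  rw [← hts, QuotientGroup.eq, this]
  exact hz

end InvolutionCommutator

/-- Let `R` be an extraspecial 2-group of plus type of order `2^(1+2d)`,
`d ≥ 2`, and `t` an automorphism of `R` of order at most 2 acting evenly on
`R/Z(R)` (its fixed-point space there has even codimension, equivalently even
dimension) such that `[R,t]` is not central.  Then `[R,t]` is abelian, `t`
inverts `[R,t]` and centralizes `Ω₁([R,t])`; in particular `t` fixes a
noncentral involution of `R`. -/
theorem even_involution_fixes_noncentral_involution
    (d : ℕ) (hd : 2 ≤ d)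
    {R : Type*} [Group R]
    (hcard : Nat.card R = 2 ^ (1 + 2 * d))
    (hZ : Nat.card (Subgroup.center R) = 2)
    (hsq : ∀ x : R, x ^ 2 ∈ Subgroup.center R)
    (hcomm : commutator R = Subgroup.center R)
    (hplus : ∃ A : Subgroup R, Nat.card A = 2 ^ (d + 1) ∧
        (∀ a ∈ A, a ^ 2 = 1) ∧ ∀ a ∈ A, ∀ b ∈ A, a * b = b * a)
    (t : R ≃* R) (ht2 : ∀ x, t (t x) = x)
    (heven : ∃ m : ℕ, Even m ∧
        Nat.card {x : R ⧸ Subgroup.center R |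
          ∃ r : R, (r : R ⧸ Subgroup.center R) = x ∧
            ((t r : R) : R ⧸ Subgroup.center R) = x} = 2 ^ m)
    (C : Subgroup R)
    (hC : C = Subgroup.closure {x : R | ∃ r : R, x = r⁻¹ * t r})
    (hnoncentral : ¬ C ≤ Subgroup.center R) :
    (∀ a ∈ C, ∀ b ∈ C, a * b = b * a) ∧
    (∀ a ∈ C, t a = a⁻¹) ∧
    (∀ a ∈ C, a ^ 2 = 1 → t a = a) ∧
    (∃ g : R, g ^ 2 = 1 ∧ g ≠ 1 ∧ g ∉ Subgroup.center R ∧ t g = g) := by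
  have hgen : ∀ r : R, r⁻¹ * t r ∈ C := fun r => hC ▸ Subgroup.subset_closure ⟨r, rfl⟩
  have htgen : ∀ r : R, t (r⁻¹ * t r) = (r⁻¹ * t r)⁻¹ := fun r => by simp [ht2]
  have hab : ∀ a ∈ C, ∀ b ∈ C, a * b = b * a := by
    subst hC
    intro a ha b hb
    induction ha, hb using Subgroup.closure_induction₂ with
    | mem x y hx hy =>
      obtain ⟨r, rfl⟩ := hx
      obtain ⟨s, rfl⟩ := hy
      exact commute_inv_mul_map hZ hcomm t (htgen r) s
    | one_left x _ => exact Commute.one_left x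
    | one_right x _ => exact Commute.one_right x
    | mul_left _ _ _ _ _ _ h₁ h₂ => exact Commute.mul_left h₁ h₂
    | mul_right _ _ _ _ _ _ h₁ h₂ => exact Commute.mul_right h₁ h₂
    | inv_left _ _ _ _ h => exact Commute.inv_left h
    | inv_right _ _ _ _ h => exact Commute.inv_right h
  have hinv : ∀ a ∈ C, t a = a⁻¹ := by
    intro a ha
    have ha' := ha
    rw [hC] at ha'
    induction ha' using Subgroup.closure_induction with
    | mem x hx => obtain ⟨r, rfl⟩ := hx; exact htgen r
    | one => simp
    | mul x y hx hy h₁ h₂ =>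
      rw [← hC] at hx hy
      rw [map_mul, h₁ hx, h₂ hy, hab x hx y hy, mul_inv_rev]
    | inv x hx h =>
      rw [← hC] at hx
      rw [map_inv, h hx]
  have hfix : ∀ a ∈ C, a ^ 2 = 1 → t a = a := fun a ha h => by
    rw [hinv a ha, inv_eq_iff_mul_eq_one, ← sq, h]
  refine ⟨hab, hinv, hfix, ?_⟩
  by_contra hno
  have hcen : ∀ g ∈ C, g ^ 2 = 1 → g ∈ Subgroup.center R := fun g hg h => by
    by_contra hgc
    exact hno ⟨g, h, fun h1 => hgc (h1 ▸ one_mem _), hgc, hfix g hg h⟩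
  obtain ⟨r, hr⟩ : ∃ r : R, r⁻¹ * t r ∉ Subgroup.center R := by
    by_contra! h
    apply hnoncentral
    rw [hC, Subgroup.closure_le]
    rintro _ ⟨r, rfl⟩
    exact h r
  let φ := centralQuotientInvMulMap hZ hcomm t
  have hrange : Nat.card φ.range = 2 := by
    rw [Nat.card_eq_two_iff' (1 : φ.range)]
    refine ⟨⟨φ r, r, rfl⟩, fun h => hr ((QuotientGroup.eq_one_iff _).1 (congrArg Subtype.val h)), ?_⟩
    rintro ⟨_, x, rfl⟩ hx
    obtain ⟨s, rfl⟩ := QuotientGroup.mk_surjective x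
    have hs : s⁻¹ * t s ∉ Subgroup.center R := fun h =>
      hx (Subtype.ext ((QuotientGroup.eq_one_iff _).2 h))
    refine Subtype.ext ?_
    change ((s⁻¹ * t s : R) : R ⧸ Subgroup.center R) = (r⁻¹ * t r : R)
    rw [QuotientGroup.eq]
    refine hcen _ (mul_mem (inv_mem (hgen s)) (hgen r)) ?_
    have hsr : Commute (s⁻¹ * t s)⁻¹ (r⁻¹ * t r) := hab _ (inv_mem (hgen s)) _ (hgen r)
    rw [hsr.mul_pow, inv_pow, inv_mul_eq_one]
    exact eq_of_mem_center_of_ne_one hZ (hsq _) (hsq _)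
      (fun h => hs (hcen _ (hgen s) h)) (fun h => hr (hcen _ (hgen r) h))
  obtain ⟨m, hm, hcardm⟩ := heven
  have hker : Nat.card φ.ker = 2 ^ m := by
    rw [← hcardm, ← coe_ker_centralQuotientInvMulMap hZ hcomm t]
    rfl
  have hquot := Subgroup.card_eq_card_quotient_mul_card_subgroup (Subgroup.center R)
  have hmul : Nat.card (R ⧸ Subgroup.center R) = 2 * 2 ^ m := by
    rw [← hker, ← hrange, ← Subgroup.index_ker, mul_comm, Subgroup.card_mul_index]
  rw [hcard, hZ, hmul, ← pow_succ', ← pow_succ] at hquot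
  have hexp := Nat.pow_right_injective le_rfl hquot
  obtain ⟨k, rfl⟩ := hm
  omega
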